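/- arXiv:math/0612314 — 3 statements merged into one kernel-verified Lean document; each statement's English description precedes it below -/
import Mathlib

section
/- Let 𝔤 be a Lie algebra over a field k, and let 𝔤₁ and 𝔪₂ be linear subspaces of 𝔤 such that 𝔤 = 𝔤₁ ⊕ 𝔪₂ (internal direct sum of vector spaces). Let N be a set of Lie algebra automorphisms of 𝔤 such that every n ∈ N fixes 𝔤₁ pointwise (n(x) = x for all x ∈ 𝔤₁) and maps 𝔪₂ into 𝔪₂. If the only vector v ∈ 𝔪₂ satisfying n(v) = v for all n ∈ N is v = 0, then 𝔤₁ is a Lie subalgebra of 𝔤, i.e. ⁅x, y⁆ ∈ 𝔤₁ for all x, y ∈ 𝔤₁. -/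
/-- If `𝔤 = 𝔤₁ ⊕ 𝔪₂` as vector spaces and a set `N` of Lie algebra automorphisms
fixes `𝔤₁` pointwise, preserves `𝔪₂`, and has no nonzero common fixed vector in `𝔪₂`,
then `𝔤₁` is a Lie subalgebra of `𝔤`. -/
theorem stmt0 {k : Type*} [Field k] {g : Type*} [LieRing g] [LieAlgebra k g]
    (g1 m2 : Submodule k g)
    (hdisj : g1 ⊓ m2 = ⊥) (hsum : g1 ⊔ m2 = ⊤)
    (N : Set (g ≃ₗ⁅k⁆ g))
    (hfix : ∀ n ∈ N, ∀ x ∈ g1, n x = x)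
    (hmap : ∀ n ∈ N, ∀ v ∈ m2, n v ∈ m2)
    (hnofix : ∀ v ∈ m2, (∀ n ∈ N, n v = v) → v = 0) :
    ∀ x ∈ g1, ∀ y ∈ g1, ⁅x, y⁆ ∈ g1 := by
  intro x hx y hy
  have h : ⁅x, y⁆ ∈ g1 ⊔ m2 := hsum ▸ Submodule.mem_top
  obtain ⟨a, ha, b, hb, hab⟩ := Submodule.mem_sup.mp h
  have hb0 : b = 0 := by
    refine hnofix b hb fun n hn => ?_
    have h1 : n ⁅x, y⁆ = ⁅x, y⁆ := by
      rw [LieEquiv.map_lie, hfix n hn x hx, hfix n hn y hy]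
    rw [← hab, map_add, hfix n hn a ha] at h1
    exact add_left_cancel h1
  rw [← hab, hb0, add_zero]
  exact ha
end

section
/- Let 𝔤 be a Lie algebra over ℝ, let 𝔤₁ and 𝔪₂ be linear subspaces with 𝔤 = 𝔤₁ ⊕ 𝔪₂ (internal direct sum of vector spaces), and let φ be a Lie algebra automorphism of 𝔤 with φ(x) = x for all x ∈ 𝔤₁ and φ(v) = λ·v for all v ∈ 𝔪₂, where λ ∈ ℝ satisfies λ ≠ 0 and λ² ≠ 1. Then ⁅v, w⁆ = 0 for all v, w ∈ 𝔪₂, and ⁅x, v⁆ ∈ 𝔪₂ for all x ∈ 𝔤₁, v ∈ 𝔪₂; consequently 𝔪₂ is an abelian Lie ideal of 𝔤. -/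
/-- If `𝔤 = 𝔤₁ ⊕ 𝔪₂` as vector spaces and `φ` is a Lie algebra automorphism of `𝔤`
fixing `𝔤₁` pointwise and acting as multiplication by `λ` on `𝔪₂` with `λ ≠ 0`,
`λ² ≠ 1`, then `𝔪₂` is an abelian Lie ideal of `𝔤`. -/
theorem stmt2 {g : Type*} [LieRing g] [LieAlgebra ℝ g]
    (g1 m2 : Submodule ℝ g)
    (hdisj : g1 ⊓ m2 = ⊥) (hsum : g1 ⊔ m2 = ⊤)
    (φ : g ≃ₗ⁅ℝ⁆ g) (lam : ℝ) (hlam0 : lam ≠ 0) (hlam1 : lam ^ 2 ≠ 1)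
    (hfix : ∀ x ∈ g1, φ x = x)
    (hscale : ∀ v ∈ m2, φ v = lam • v) :
    (∀ v ∈ m2, ∀ w ∈ m2, ⁅v, w⁆ = 0) ∧
    (∀ x ∈ g1, ∀ v ∈ m2, ⁅x, v⁆ ∈ m2) ∧
    (∀ z : g, ∀ v ∈ m2, ⁅z, v⁆ ∈ m2) := by
  have key : ∀ (u : g) (μ : ℝ), μ ≠ 1 → φ u = μ • u → u ∈ m2 := by
    intro u μ hμ hu
    obtain ⟨a, ha, b, hb, rfl⟩ := Submodule.mem_sup.1 (hsum ▸ Submodule.mem_top : u ∈ g1 ⊔ m2)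
    rw [map_add, hfix a ha, hscale b hb] at hu
    have e : (1 - μ) • a = (μ - lam) • b := by
      rw [sub_smul, sub_smul, one_smul, sub_eq_sub_iff_add_eq_add, hu, smul_add, add_comm]
    have h : (1 - μ) • a ∈ g1 ⊓ m2 :=
      ⟨g1.smul_mem _ ha, e ▸ m2.smul_mem _ hb⟩
    rw [hdisj, Submodule.mem_bot, smul_eq_zero] at h
    rcases h with h | h
    · exact absurd (sub_eq_zero.1 h).symm hμ
    · rw [h, zero_add]; exact hb
  have hl1 : lam ≠ 1 := by
    rintro rfl
    exact hlam1 (by norm_num)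
  have h1 : ∀ v ∈ m2, ∀ w ∈ m2, ⁅v, w⁆ = 0 := by
    intro v hv w hw
    have e : φ ⁅v, w⁆ = (lam ^ 2) • ⁅v, w⁆ := by
      rw [LieEquiv.map_lie, hscale v hv, hscale w hw, smul_lie, lie_smul, smul_smul, sq]
    have hm := key _ _ hlam1 e
    rw [hscale _ hm, ← sub_eq_zero, ← sub_smul, smul_eq_zero] at e
    rcases e with e | e
    · have : lam * (1 - lam) = 0 := by linarith
      rcases mul_eq_zero.1 this with h | h
      · exact absurd h hlam0
      · exact absurd (sub_eq_zero.1 h).symm hl1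
    · exact e
  have h2 : ∀ x ∈ g1, ∀ v ∈ m2, ⁅x, v⁆ ∈ m2 := by
    intro x hx v hv
    refine key _ lam hl1 ?_
    rw [LieEquiv.map_lie, hfix x hx, hscale v hv, lie_smul]
  refine ⟨h1, h2, ?_⟩
  intro z v hv
  obtain ⟨a, ha, b, hb, rfl⟩ := Submodule.mem_sup.1 (hsum ▸ Submodule.mem_top : z ∈ g1 ⊔ m2)
  rw [add_lie, h1 b hb v hv, add_zero]
  exact h2 a ha v hv
end

section
/- Let R be a commutative ring, V an R-module, Q a quadratic form on V, and ι : V → Cl(Q) the canonical linear embedding into the Clifford algebra of Q. Let L be the R-submodule of Cl(Q) generated by the image ι(V) together with all products ι(v) * ι(w) for v, w ∈ V (i.e. L = range(ι) ⊔ range(ι)·range(ι) as submodules). Then L is closed under the ring commutator: for all a, b ∈ L, ⁅a, b⁆ = a*b - b*a ∈ L. In particular, L is a Lie subalgebra of Cl(Q) with its commutator bracket. -/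
theorem aux_comm3 {R : Type*} [CommRing R] {V : Type*} [AddCommGroup V] [Module R V]
    (Q : QuadraticForm R V) (c x : CliffordAlgebra Q)
    (hc : c ∈ LinearMap.range (CliffordAlgebra.ι Q) * LinearMap.range (CliffordAlgebra.ι Q))
    (hx : x ∈ LinearMap.range (CliffordAlgebra.ι Q)) :
    c * x - x * c ∈ LinearMap.range (CliffordAlgebra.ι Q) := by
  induction hc using Submodule.mul_induction_on' with
  | mem_mul_mem m hm n hn =>
    obtain ⟨v, rfl⟩ := hm
    obtain ⟨w, rfl⟩ := hn
    obtain ⟨u, rfl⟩ := hx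
    refine ⟨QuadraticMap.polar Q w u • v - QuadraticMap.polar Q v u • w, ?_⟩
    rw [map_sub, map_smul, map_smul, Algebra.smul_def, Algebra.smul_def, Algebra.commutes,
      ← CliffordAlgebra.ι_mul_ι_add_swap, ← CliffordAlgebra.ι_mul_ι_add_swap]
    noncomm_ring
  | add a ha b hb iha ihb =>
    have e : (a + b) * x - x * (a + b) = (a * x - x * a) + (b * x - x * b) := by noncomm_ring
    rw [e]
    exact add_mem iha ihb

theorem aux_comm4 {R : Type*} [CommRing R] {V : Type*} [AddCommGroup V] [Module R V]
    (Q : QuadraticForm R V) (c d : CliffordAlgebra Q)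
    (hc : c ∈ LinearMap.range (CliffordAlgebra.ι Q) * LinearMap.range (CliffordAlgebra.ι Q))
    (hd : d ∈ LinearMap.range (CliffordAlgebra.ι Q) * LinearMap.range (CliffordAlgebra.ι Q)) :
    c * d - d * c ∈
      LinearMap.range (CliffordAlgebra.ι Q) * LinearMap.range (CliffordAlgebra.ι Q) := by
  induction hd using Submodule.mul_induction_on' with
  | mem_mul_mem m hm n hn =>
    have e : c * (m * n) - m * n * c = (c * m - m * c) * n + m * (c * n - n * c) := by
      noncomm_ring
    rw [e]
    exact add_mem (Submodule.mul_mem_mul (aux_comm3 Q c m hc hm) hn)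
      (Submodule.mul_mem_mul hm (aux_comm3 Q c n hc hn))
  | add a ha b hb iha ihb =>
    have e : c * (a + b) - (a + b) * c = (c * a - a * c) + (c * b - b * c) := by noncomm_ring
    rw [e]
    exact add_mem iha ihb

/-- The submodule of the Clifford algebra generated by `ι(V)` together with the
products `ι(v) * ι(w)` is closed under the ring commutator, i.e. it is a Lie
subalgebra of the Clifford algebra with its commutator bracket. -/
theorem stmt9 {R : Type*} [CommRing R] {V : Type*} [AddCommGroup V] [Module R V]
    (Q : QuadraticForm R V) :
    ∀ a ∈ LinearMap.range (CliffordAlgebra.ι Q) ⊔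
        LinearMap.range (CliffordAlgebra.ι Q) * LinearMap.range (CliffordAlgebra.ι Q),
      ∀ b ∈ LinearMap.range (CliffordAlgebra.ι Q) ⊔
          LinearMap.range (CliffordAlgebra.ι Q) * LinearMap.range (CliffordAlgebra.ι Q),
        ⁅a, b⁆ ∈ LinearMap.range (CliffordAlgebra.ι Q) ⊔
          LinearMap.range (CliffordAlgebra.ι Q) * LinearMap.range (CliffordAlgebra.ι Q) := by
  intro a ha b hb
  obtain ⟨x, hx, c, hc, rfl⟩ := Submodule.mem_sup.1 ha
  obtain ⟨y, hy, d, hd, rfl⟩ := Submodule.mem_sup.1 hb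
  have e : ⁅x + c, y + d⁆ = ((c * y - y * c) - (d * x - x * d)) +
      ((x * y - y * x) + (c * d - d * c)) := by
    rw [Ring.lie_def]
    noncomm_ring
  rw [e]
  exact Submodule.add_mem_sup (sub_mem (aux_comm3 Q c y hc hy) (aux_comm3 Q d x hd hx))
    (add_mem (sub_mem (Submodule.mul_mem_mul hx hy) (Submodule.mul_mem_mul hy hx))
      (aux_comm4 Q c d hc hd))
end
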